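/- Let μ be a probability distribution on S such that G[supp μ] is connected. Then every time-homogeneous Markov chain X = (X(t) : t ∈ ℕ) with state space supp μ, arbitrary initial distribution, and transition matrix P^{(μ, G[supp μ])} (the matrix constructed from the restriction of μ to supp μ and the induced subgraph G[supp μ]) is consistent with G, and its empirical distribution converges to μ: for every s ∈ S, lim_{t→∞} (1/t) Σ_{m=0}^{t−1} 1_{{X(m)=s}} = μ(s) almost surely. -/

import Mathlib

open Finset Filter MeasureTheory

attribute [local instance] Classical.propDecidable

/-- The denominator appearing in the definition of the constant `p`:
`Σ_{m>l} 1_{{s^l,s^m} ∈ E} + Σ_{m<l} (ν(s^m)/ν(s^l)) 1_{{s^l,s^m} ∈ E}`. -/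
noncomputable def denomP {V : Type*} [Fintype V] [LinearOrder V]
    (G : SimpleGraph V) (ν : V → ℝ) (l : V) : ℝ :=
  (∑ m, if l < m ∧ G.Adj l m then (1 : ℝ) else 0)
    + ∑ m, if m < l ∧ G.Adj l m then ν m / ν l else 0

/-- The constant `p = min_l 1/(2 · denom(l))`. -/
noncomputable def pconst {V : Type*} [Fintype V] [LinearOrder V]
    (G : SimpleGraph V) (ν : V → ℝ) : ℝ :=
  ⨅ l, 1 / (2 * denomP G ν l)

/-- The transition matrix `P^{(ν,G)}`. -/
noncomputable def Pmat {V : Type*} [Fintype V] [LinearOrder V]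
    (G : SimpleGraph V) (ν : V → ℝ) : Matrix V V ℝ :=
  Matrix.of fun l m =>
    if l = m then 1 - pconst G ν * denomP G ν l
    else if l < m ∧ G.Adj l m then pconst G ν
    else if m < l ∧ G.Adj l m then (ν m / ν l) * pconst G ν
    else 0

/-- `X = (X(t) : t ∈ ℕ)` is a (possibly non-homogeneous) Markov chain with one-step
transition matrix `T t` at time `t` (and arbitrary initial distribution, namely the
law of `X 0`): the finite-dimensional distributions factorize as
`P(X_0 = x_0, …, X_{n+1} = x_{n+1}) = P(X_0 = x_0) ∏_{i=0}^{n} T i (x_i, x_{i+1})`. -/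
def IsMarkovOn {Ω S : Type*} [MeasurableSpace Ω] (P : MeasureTheory.Measure Ω)
    (X : ℕ → Ω → S) (T : ℕ → Matrix S S ℝ) : Prop :=
  ∀ (n : ℕ) (path : ℕ → S),
    (P {ω | ∀ i ≤ n + 1, X i ω = path i}).toReal
      = (P {ω | X 0 ω = path 0}).toReal
        * ∏ i ∈ Finset.range (n + 1), T i (path i) (path (i + 1))

/-- The process `X` is consistent with the graph `G`: with probability one,
`X(t)` and `X(t+1)` are adjacent in `G` (i.e. equal or joined by an edge). -/
def ConsistentWith {Ω V : Type*} [MeasurableSpace Ω] (P : MeasureTheory.Measure Ω)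
    (X : ℕ → Ω → V) (G : SimpleGraph V) : Prop :=
  ∀ t : ℕ, P {ω | X t ω = X (t + 1) ω ∨ G.Adj (X t ω) (X (t + 1) ω)} = 1

section SecondMoment

/-- If the partial sums of a uniformly bounded sequence of random variables have second moments
growing at most linearly, then their averages tend to zero almost surely. -/
lemma ae_tendsto_average_zero_of_integral_sq_le {Ω : Type*} [MeasurableSpace Ω] {P : Measure Ω}
    [IsFiniteMeasure P] {D : ℕ → Ω → ℝ} (hD : ∀ n, Measurable (D n)) {C K : ℝ}
    (hC : ∀ n ω, |D n ω| ≤ C)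
    (hK : ∀ n : ℕ, ∫ ω, (∑ m ∈ range n, D m ω) ^ 2 ∂P ≤ K * n) :
    ∀ᵐ ω ∂P, Tendsto (fun n : ℕ => (∑ m ∈ range n, D m ω) / n) atTop (nhds 0) := by
  set S : ℕ → Ω → ℝ := fun n ω => ∑ m ∈ range n, D m ω with hS
  have hSm : ∀ n, Measurable (S n) := fun n => Finset.measurable_sum _ fun m _ => hD m
  have hSb : ∀ n ω, |S n ω| ≤ n * C := fun n ω => by
    refine (Finset.abs_sum_le_sum_abs _ _).trans ?_
    simpa using Finset.sum_le_sum fun m (_ : m ∈ range n) => hC m ω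
  have hSi : ∀ n, Integrable (fun ω => (S n ω) ^ 2) P := fun n =>
    Integrable.of_bound ((hSm n).pow_const 2).aestronglyMeasurable ((n * C) ^ 2)
      (Eventually.of_forall fun ω => by
        rw [Real.norm_eq_abs, abs_pow]
        exact pow_le_pow_left₀ (abs_nonneg _) (hSb n ω) 2)
  let Y : ℕ → Ω → ℝ := fun k ω => (S (k ^ 2) ω / (k ^ 2 : ℕ)) ^ 2
  have hYm : ∀ k, Measurable (Y k) := fun k => ((hSm _).div_const _).pow_const 2
  have hYi : ∀ k, ∫ ω, Y k ω ∂P ≤ K * (1 / (k : ℝ) ^ 2) := fun k => by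
    rcases Nat.eq_zero_or_pos k with rfl | hk
    · simp [Y]
    have hk' : (0 : ℝ) < k := by exact_mod_cast hk
    have h := hK (k ^ 2)
    simp only [Y, div_pow, integral_div]
    rw [div_le_iff₀ (by positivity)]
    refine h.trans (le_of_eq ?_)
    push_cast
    field_simp
  have hsum : ∑' k, ∫⁻ ω, ENNReal.ofReal (Y k ω) ∂P ≠ ⊤ := by
    have hs : Summable fun k : ℕ => K * (1 / (k : ℝ) ^ 2) :=
      (Real.summable_one_div_nat_pow.2 one_lt_two).mul_left K
    refine ne_top_of_le_ne_top hs.tsum_ofReal_ne_top (ENNReal.tsum_le_tsum fun k => ?_)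
    rw [← ofReal_integral_eq_lintegral_ofReal]
    · exact ENNReal.ofReal_le_ofReal (hYi k)
    · simp only [Y, div_pow]
      exact (hSi _).div_const _
    · exact Eventually.of_forall fun ω => sq_nonneg _
  rw [← lintegral_tsum fun k => (hYm k).ennreal_ofReal.aemeasurable] at hsum
  filter_upwards [ae_lt_top' (AEMeasurable.tsum
    fun k => (hYm k).ennreal_ofReal.aemeasurable) hsum] with ω hω
  have hY0 : Tendsto (fun k => Y k ω) atTop (nhds 0) := by
    have h := (ENNReal.tendsto_toReal ENNReal.zero_ne_top).comp
      (ENNReal.tendsto_atTop_zero_of_tsum_ne_top hω.ne)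
    refine h.congr fun k => ?_
    exact ENNReal.toReal_ofReal (sq_nonneg _)
  have hsq : Tendsto (fun k : ℕ => |S (k ^ 2) ω / (k ^ 2 : ℕ)|) atTop (nhds 0) := by
    have h := (Real.continuous_sqrt.tendsto 0).comp hY0
    rw [Real.sqrt_zero] at h
    exact h.congr fun k => Real.sqrt_sq_eq_abs _
  have hroot : Tendsto Nat.sqrt atTop atTop :=
    tendsto_atTop_atTop.2 fun b => ⟨b * b, fun a ha => Nat.le_sqrt.2 ha⟩
  have hbound : Tendsto (fun n : ℕ => |S (n.sqrt ^ 2) ω / (n.sqrt ^ 2 : ℕ)| +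
      2 * C * (1 / (n.sqrt : ℝ))) atTop (nhds 0) := by
    have h := (hsq.add (tendsto_one_div_atTop_nhds_zero_nat.const_mul (2 * C))).comp hroot
    rwa [mul_zero, add_zero] at h
  refine squeeze_zero_norm' ?_ hbound
  filter_upwards [eventually_ge_atTop 1] with n hn
  have hC0 : 0 ≤ C := (abs_nonneg _).trans (hC 0 ω)
  set k := n.sqrt with hk
  have hk1 : 1 ≤ k := Nat.le_sqrt.2 (by simpa using hn)
  have hkn : k ^ 2 ≤ n := Nat.sqrt_le' n
  have hnk : n ≤ k ^ 2 + 2 * k := by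
    have := Nat.sqrt_le_add n
    rw [← hk] at this
    nlinarith
  have hdiff : |S n ω| ≤ |S (k ^ 2) ω| + 2 * k * C := by
    have h1 : S n ω = S (k ^ 2) ω + ∑ m ∈ Ico (k ^ 2) n, D m ω :=
      (Finset.sum_range_add_sum_Ico _ hkn).symm
    have h2 : |∑ m ∈ Ico (k ^ 2) n, D m ω| ≤ (n - k ^ 2 : ℕ) * C := by
      refine (Finset.abs_sum_le_sum_abs _ _).trans ?_
      simpa using Finset.sum_le_sum fun m (_ : m ∈ Ico (k ^ 2) n) => hC m ω
    have h3 : ((n - k ^ 2 : ℕ) : ℝ) ≤ 2 * k := by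
      exact_mod_cast (by omega : n - k ^ 2 ≤ 2 * k)
    rw [h1]
    exact (abs_add_le _ _).trans
      (add_le_add_right (h2.trans (mul_le_mul_of_nonneg_right h3 hC0)) _)
  have hkpos : (0 : ℝ) < k := by exact_mod_cast hk1
  have hkn' : ((k : ℝ) ^ 2) ≤ n := by exact_mod_cast hkn
  have hkk : (0 : ℝ) < (k : ℝ) ^ 2 := by positivity
  rw [Real.norm_eq_abs, abs_div, abs_div, Nat.abs_cast, Nat.abs_cast]
  calc |S n ω| / n ≤ (|S (k ^ 2) ω| + 2 * k * C) / (k : ℝ) ^ 2 :=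
        div_le_div₀ (by positivity) hdiff hkk hkn'
    _ = |S (k ^ 2) ω| / ((k ^ 2 : ℕ) : ℝ) + 2 * C * (1 / (k : ℝ)) := by
        push_cast
        field_simp

end SecondMoment

section HarmonicFunctions

/-- For a positive invariant distribution, harmonic functions take the same value at both ends of
a transition of positive probability. -/
lemma eq_of_harmonic_of_invariant {V : Type*} [Fintype V] {T : Matrix V V ℝ}
    {π : V → ℝ} (hT : ∀ x, ∑ y, T x y = 1)
    (hT0 : ∀ x y, x ≠ y → 0 ≤ T x y) (hπ : ∀ x, 0 < π x)
    (hinv : ∀ y, ∑ x, π x * T x y = π y) {h : V → ℝ} (hh : ∀ x, ∑ y, T x y * h y = h x)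
    {x y : V} (hxy : 0 < T x y) : h x = h y := by
  have hnn : ∀ x y, 0 ≤ π x * T x y * (h x - h y) ^ 2 := fun x y => by
    rcases eq_or_ne x y with rfl | hne
    · simp
    · have := hT0 x y hne
      have := (hπ x).le
      positivity
  have h1 : ∀ x, ∑ y, π x * T x y * (h x - h y) ^ 2 =
      ∑ y, π x * T x y * h y ^ 2 - π x * h x ^ 2 := fun x => by
    have e : ∀ y, π x * T x y * (h x - h y) ^ 2 = π x * h x ^ 2 * T x y -
        2 * π x * h x * (T x y * h y) + π x * T x y * h y ^ 2 := fun y => by ring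
    simp_rw [e, Finset.sum_add_distrib, Finset.sum_sub_distrib, ← Finset.mul_sum, hT, hh]
    ring
  have h0 : ∑ x, ∑ y, π x * T x y * (h x - h y) ^ 2 = 0 := by
    simp_rw [h1, Finset.sum_sub_distrib]
    rw [Finset.sum_comm]
    simp_rw [← Finset.sum_mul, hinv, sub_self]
  have hx := (Finset.sum_eq_zero_iff_of_nonneg fun x _ =>
    Finset.sum_nonneg fun y _ => hnn x y).1 h0 x (mem_univ x)
  have hxy0 := (Finset.sum_eq_zero_iff_of_nonneg fun y _ => hnn x y).1 hx y (mem_univ y)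
  have hpos := mul_pos (hπ x) hxy
  exact sub_eq_zero.1 (pow_eq_zero_iff two_ne_zero |>.1
    ((mul_eq_zero.1 hxy0).resolve_left hpos.ne'))

/-- Solvability of the Poisson equation for a matrix with an invariant distribution whose only
harmonic functions are constant. -/
lemma exists_poisson_solution {V : Type*} [Fintype V] {T : Matrix V V ℝ} {π : V → ℝ}
    (hπ : ∑ x, π x = 1) (hinv : ∀ y, ∑ x, π x * T x y = π y)
    (hharm : ∀ h : V → ℝ, (∀ x, ∑ y, T x y * h y = h x) → ∀ x y, h x = h y)
    (f : V → ℝ) (hf : ∑ x, π x * f x = 0) :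
    ∃ g : V → ℝ, ∀ x, g x - ∑ y, T x y * g y = f x := by
  let L : (V → ℝ) →ₗ[ℝ] (V → ℝ) :=
    { toFun := fun h x => h x - ∑ y, T x y * h y + ∑ y, π y * h y
      map_add' := fun h k => by
        funext x
        simp only [Pi.add_apply, mul_add, Finset.sum_add_distrib]
        ring
      map_smul' := fun c h => by
        funext x
        simp only [Pi.smul_apply, smul_eq_mul, RingHom.id_apply, mul_left_comm _ c,
          ← Finset.mul_sum]
        ring }
  have hL : ∀ h x, L h x = h x - ∑ y, T x y * h y + ∑ y, π y * h y := fun _ _ => rfl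
  have hmean : ∀ h, ∑ x, π x * L h x = ∑ x, π x * h x := fun h => by
    have h1 : ∑ x, π x * ∑ y, T x y * h y = ∑ y, π y * h y := by
      simp_rw [Finset.mul_sum, ← mul_assoc]
      rw [Finset.sum_comm]
      simp_rw [← Finset.sum_mul, hinv]
    simp only [hL, mul_add, mul_sub, Finset.sum_add_distrib, Finset.sum_sub_distrib, h1,
      ← Finset.sum_mul, hπ]
    ring
  have hinj : Function.Injective L := by
    rw [← LinearMap.ker_eq_bot, LinearMap.ker_eq_bot']
    intro h hh
    have h0 : ∑ x, π x * h x = 0 := by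
      rw [← hmean, hh]
      simp
    have hconst := hharm h fun x => by
      have := congrFun hh x
      rw [hL, h0, Pi.zero_apply] at this
      linarith
    funext x
    have : ∑ y, π y * h y = h x := by
      simp_rw [fun y => hconst y x, ← Finset.sum_mul, hπ, one_mul]
    rw [← this, h0, Pi.zero_apply]
  obtain ⟨g, hg⟩ := LinearMap.injective_iff_surjective.1 hinj f
  refine ⟨g, fun x => ?_⟩
  have h0 : ∑ x, π x * g x = 0 := by rw [← hmean, hg, hf]
  rw [← hg, hL, h0, add_zero]

end HarmonicFunctions

section FiniteChain

variable {Ω V : Type*} [MeasurableSpace Ω] {P : Measure Ω} {X : ℕ → Ω → V}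

lemma IsMarkovOn.measureReal_history_succ {T : ℕ → Matrix V V ℝ}
    (hX : IsMarkovOn P X T) (n : ℕ) (path : ℕ → V) :
    P.real {ω | ∀ i ≤ n + 1, X i ω = path i} =
      P.real {ω | ∀ i ≤ n, X i ω = path i} * T n (path n) (path (n + 1)) := by
  have h := hX n path
  rcases n with _ | n
  · simpa [measureReal_def] using h
  · rw [Finset.prod_range_succ, ← mul_assoc, ← hX n path] at h
    exact h

/-- One step of a Markov chain, conditionally on its history. -/
lemma IsMarkovOn.measureReal_step {T : ℕ → Matrix V V ℝ}
    (hX : IsMarkovOn P X T) (n : ℕ) (h : Fin (n + 1) → V) (y : V) :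
    P.real {ω | ((fun i : Fin (n + 1) => X i ω), X (n + 1) ω) = (h, y)} =
      P.real {ω | (fun i : Fin (n + 1) => X i ω) = h} * T n (h (Fin.last n)) y := by
  have key := hX.measureReal_history_succ n
    fun i => if hi : i < n + 1 then h ⟨i, hi⟩ else y
  simp only [lt_add_iff_pos_right, zero_lt_one, dite_true, lt_irrefl, dite_false] at key
  have hhist : ∀ ω, (∀ i ≤ n, X i ω = if hi : i < n + 1 then h ⟨i, hi⟩ else y) ↔
      (fun i : Fin (n + 1) => X i ω) = h := fun ω => by
    constructor
    · intro H
      funext i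
      rw [H i (Nat.lt_succ_iff.1 i.2), dif_pos i.2]
    · rintro rfl i hi
      simp [Nat.lt_succ_iff.2 hi]
  have hstep : ∀ ω, (∀ i ≤ n + 1, X i ω = if hi : i < n + 1 then h ⟨i, hi⟩ else y) ↔
      ((fun i : Fin (n + 1) => X i ω), X (n + 1) ω) = (h, y) := fun ω => by
    rw [Prod.mk.injEq, ← hhist]
    constructor
    · exact fun H => ⟨fun i hi => H i (hi.trans n.le_succ), by simpa using H (n + 1) le_rfl⟩
    · rintro ⟨H, H'⟩ i hi
      rcases Nat.le_succ_iff.1 hi with hi | rfl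
      · exact H i hi
      · simpa using H'
  simp only [hhist, hstep] at key
  exact key

/-- Almost surely, a finite Markov chain only makes transitions of nonzero probability. -/
lemma IsMarkovOn.ae_transition_ne_zero [Finite V] [IsFiniteMeasure P] {T : ℕ → Matrix V V ℝ}
    (hX : IsMarkovOn P X T) (n : ℕ) : ∀ᵐ ω ∂P, T n (X n ω) (X (n + 1) ω) ≠ 0 := by
  have hnull : ∀ z : (Fin (n + 1) → V) × V, T n (z.1 (Fin.last n)) z.2 = 0 →
      ∀ᵐ ω ∂P, ((fun i : Fin (n + 1) => X i ω), X (n + 1) ω) ≠ z := fun z hz => by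
    have h := hX.measureReal_step n z.1 z.2
    rw [hz, mul_zero, measureReal_eq_zero_iff] at h
    simpa [ae_iff] using h
  have hall : ∀ᵐ ω ∂P, ∀ z : (Fin (n + 1) → V) × V, T n (z.1 (Fin.last n)) z.2 = 0 →
      ((fun i : Fin (n + 1) => X i ω), X (n + 1) ω) ≠ z :=
    ae_all_iff.2 fun z => by
      by_cases hz : T n (z.1 (Fin.last n)) z.2 = 0
      · filter_upwards [hnull z hz] with ω hω _ using hω
      · exact Eventually.of_forall fun ω hz' => absurd hz' hz
  filter_upwards [hall] with ω hω h0
  exact hω ((fun i : Fin (n + 1) => X i ω), X (n + 1) ω) h0 rfl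

variable [Fintype V] [MeasurableSpace V] [MeasurableSingletonClass V]

lemma integral_comp_eq_sum {W : Type*} [Fintype W] [MeasurableSpace W]
    [MeasurableSingletonClass W] [IsFiniteMeasure P] {Y : Ω → W} (hY : Measurable Y)
    (φ : W → ℝ) : ∫ ω, φ (Y ω) ∂P = ∑ y, P.real {ω | Y ω = y} * φ y := by
  rw [← integral_map (f := φ) hY.aemeasurable (measurable_of_finite φ).aestronglyMeasurable,
    integral_fintype (.of_finite)]
  refine Finset.sum_congr rfl fun y _ => ?_
  rw [map_measureReal_apply hY (measurableSet_singleton y), smul_eq_mul]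
  rfl

/-- The increments `g (X (n + 1)) - (T g) (X n)` of a finite Markov chain are orthogonal to every
function of the history. -/
lemma IsMarkovOn.integral_history_mul_increment_eq_zero [IsFiniteMeasure P]
    {T : ℕ → Matrix V V ℝ} (hX : IsMarkovOn P X T) (hXm : ∀ n, Measurable (X n))
    (hT : ∀ n x, ∑ y, T n x y = 1) (g : V → ℝ) (n : ℕ) (F : (Fin (n + 1) → V) → ℝ) :
    ∫ ω, F (fun i => X i ω) * (g (X (n + 1) ω) - ∑ y, T n (X n ω) y * g y) ∂P = 0 := by
  have hY : Measurable fun ω => ((fun i : Fin (n + 1) => X i ω), X (n + 1) ω) :=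
    (measurable_pi_lambda _ fun i : Fin (n + 1) => hXm i).prodMk (hXm (n + 1))
  have h := integral_comp_eq_sum (P := P) hY
    (fun z => F z.1 * (g z.2 - ∑ y, T n (z.1 (Fin.last n)) y * g y))
  simp only [Fin.val_last] at h
  rw [h, Fintype.sum_prod_type]
  refine Finset.sum_eq_zero fun x _ => ?_
  simp_rw [hX.measureReal_step n x, mul_assoc]
  rw [← Finset.mul_sum]
  have : ∑ y, T n (x (Fin.last n)) y *
      (F x * (g y - ∑ z, T n (x (Fin.last n)) z * g z)) = 0 := by
    simp_rw [mul_left_comm _ (F x), ← Finset.mul_sum, mul_sub, Finset.sum_sub_distrib,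
      ← Finset.sum_mul, hT, one_mul, sub_self, mul_zero]
  rw [this, mul_zero]

/-- The ergodic theorem for a finite Markov chain whose only harmonic functions are constant. -/
theorem IsMarkovOn.ae_tendsto_average [IsProbabilityMeasure P] {T : Matrix V V ℝ} {π : V → ℝ}
    (hX : IsMarkovOn P X fun _ => T) (hXm : ∀ n, Measurable (X n)) (hT : ∀ x, ∑ y, T x y = 1)
    (hπ : ∑ x, π x = 1) (hinv : ∀ y, ∑ x, π x * T x y = π y)
    (hharm : ∀ h : V → ℝ, (∀ x, ∑ y, T x y * h y = h x) → ∀ x y, h x = h y) (f : V → ℝ) :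
    ∀ᵐ ω ∂P, Tendsto (fun t : ℕ => (∑ m ∈ range t, f (X m ω)) / t) atTop
      (nhds (∑ x, π x * f x)) := by
  set c := ∑ x, π x * f x with hc
  obtain ⟨g, hg⟩ := exists_poisson_solution hπ hinv hharm (fun x => f x - c) (by
    simp_rw [mul_sub, Finset.sum_sub_distrib, ← Finset.sum_mul, hπ, one_mul, ← hc, sub_self])
  have hbdd : ∀ φ : V → ℝ, ∀ x, |φ x| ≤ ∑ y, |φ y| := fun φ x =>
    Finset.single_le_sum (f := fun y => |φ y|) (fun _ _ => abs_nonneg _) (mem_univ x)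
  set A : ℝ := ∑ y, |g y|
  set Tg : V → ℝ := fun x => ∑ y, T x y * g y with hTg
  set C : ℝ := A + ∑ y, |Tg y|
  let D : ℕ → Ω → ℝ := fun n ω => g (X (n + 1) ω) - Tg (X n ω)
  have hDm : ∀ n, Measurable (D n) := fun n =>
    ((measurable_of_finite g).comp (hXm _)).sub ((measurable_of_finite Tg).comp (hXm _))
  have hDb : ∀ n ω, |D n ω| ≤ C := fun n ω =>
    (abs_sub _ _).trans (add_le_add (hbdd g _) (hbdd Tg _))
  have hint : ∀ {φ : Ω → ℝ} {B : ℝ}, Measurable φ → (∀ ω, |φ ω| ≤ B) → Integrable φ P :=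
    fun hφ hB => Integrable.of_bound hφ.aestronglyMeasurable _ (Eventually.of_forall hB)
  have hSm : ∀ n, Measurable fun ω => ∑ m ∈ range n, D m ω := fun n =>
    Finset.measurable_sum _ fun m _ => hDm m
  have hSb : ∀ n ω, |∑ m ∈ range n, D m ω| ≤ n * C := fun n ω => by
    refine (Finset.abs_sum_le_sum_abs _ _).trans ?_
    simpa using Finset.sum_le_sum fun m (_ : m ∈ range n) => hDb m ω
  have hmoment : ∀ n : ℕ, ∫ ω, (∑ m ∈ range n, D m ω) ^ 2 ∂P ≤ C ^ 2 * n := by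
    intro n
    induction n with
    | zero => simp
    | succ n ih =>
      have horth : ∫ ω, (∑ m ∈ range n, D m ω) * D n ω ∂P = 0 := by
        have h := hX.integral_history_mul_increment_eq_zero hXm (fun _ => hT) g n
          fun h => ∑ m : Fin n, (g (h m.succ) - Tg (h m.castSucc))
        rw [← h]
        refine integral_congr_ae (Eventually.of_forall fun ω => ?_)
        have : ∑ m ∈ range n, D m ω = ∑ m : Fin n, (g (X (m + 1) ω) - Tg (X m ω)) :=
          (Fin.sum_univ_eq_sum_range (fun m => D m ω) n).symm
        simp only [this, Fin.val_succ, Fin.val_castSucc]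
        rfl
      have hi1 : Integrable (fun ω => (∑ m ∈ range n, D m ω) ^ 2) P :=
        hint ((hSm n).pow_const 2) (B := (n * C) ^ 2) fun ω => by
          rw [abs_pow]
          exact pow_le_pow_left₀ (abs_nonneg _) (hSb n ω) 2
      have hi2 : Integrable (fun ω => 2 * ((∑ m ∈ range n, D m ω) * D n ω)) P :=
        (hint (φ := fun ω => (∑ m ∈ range n, D m ω) * D n ω) ((hSm n).mul (hDm n))
          (B := n * C * C) fun ω => by
          rw [abs_mul]
          exact mul_le_mul (hSb n ω) (hDb n ω) (abs_nonneg _)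
            ((abs_nonneg _).trans (hSb n ω))).const_mul 2
      have hi12 : Integrable (fun ω => (∑ m ∈ range n, D m ω) ^ 2 +
          2 * ((∑ m ∈ range n, D m ω) * D n ω)) P := hi1.add hi2
      have hDsq : ∀ ω, D n ω ^ 2 ≤ C ^ 2 := fun ω => by
        rw [← sq_abs]
        exact pow_le_pow_left₀ (abs_nonneg _) (hDb n ω) 2
      have hi3 : Integrable (fun ω => D n ω ^ 2) P :=
        hint ((hDm n).pow_const 2) (B := C ^ 2) fun ω => by
          rw [abs_of_nonneg (sq_nonneg _)]
          exact hDsq ω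
      have hexp : ∀ ω, (∑ m ∈ range (n + 1), D m ω) ^ 2 = (∑ m ∈ range n, D m ω) ^ 2 +
          2 * ((∑ m ∈ range n, D m ω) * D n ω) + D n ω ^ 2 := fun ω => by
        rw [Finset.sum_range_succ]
        ring
      have h3 : ∫ ω, D n ω ^ 2 ∂P ≤ C ^ 2 := by
        simpa using integral_mono hi3 (integrable_const (C ^ 2)) hDsq
      simp_rw [hexp]
      rw [integral_add hi12 hi3, integral_add hi1 hi2, integral_const_mul, horth]
      push_cast
      linarith
  filter_upwards [ae_tendsto_average_zero_of_integral_sq_le hDm hDb hmoment] with ω hω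
  have hbd : Tendsto (fun t : ℕ => (g (X 0 ω) - g (X t ω)) / t) atTop (nhds 0) := by
    refine squeeze_zero_norm (a := fun t : ℕ => 2 * A * (1 / (t : ℝ))) (fun t => ?_) ?_
    · rw [Real.norm_eq_abs, abs_div, Nat.abs_cast, mul_one_div]
      refine div_le_div_of_nonneg_right ?_ (Nat.cast_nonneg _)
      linarith [abs_sub (g (X 0 ω)) (g (X t ω)), hbdd g (X 0 ω), hbdd g (X t ω)]
    · simpa using tendsto_one_div_atTop_nhds_zero_nat.const_mul (2 * A)
  have hlim := (hbd.add hω).add_const c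
  rw [add_zero, zero_add] at hlim
  refine hlim.congr' ?_
  filter_upwards [eventually_ge_atTop 1] with t ht
  have ht' : (t : ℝ) ≠ 0 := by positivity
  have htel : ∑ m ∈ range t, f (X m ω) =
      (g (X 0 ω) - g (X t ω)) + ∑ m ∈ range t, D m ω + t * c := by
    have h1 : ∀ m, f (X m ω) = (g (X m ω) - g (X (m + 1) ω)) + D m ω + c := fun m => by
      have := hg (X m ω)
      simp only [D, hTg]
      linarith
    simp_rw [h1, Finset.sum_add_distrib, Finset.sum_range_sub', Finset.sum_const, card_range,
      nsmul_eq_mul]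
  rw [htel]
  field_simp

end FiniteChain

section TransitionMatrix

variable {V : Type*} [Fintype V] [LinearOrder V] {G : SimpleGraph V} {ν : V → ℝ}

lemma Pmat_apply_self (l : V) : Pmat G ν l l = 1 - pconst G ν * denomP G ν l := by
  simp [Pmat]

lemma Pmat_apply_of_lt {l m : V} (h : l < m) :
    Pmat G ν l m = if G.Adj l m then pconst G ν else 0 := by
  simp [Pmat, h, h.ne, h.not_gt]

lemma Pmat_apply_of_gt {l m : V} (h : m < l) :
    Pmat G ν l m = if G.Adj l m then ν m / ν l * pconst G ν else 0 := by
  simp [Pmat, h, h.ne', h.not_gt]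

lemma Pmat_row_sum (l : V) : ∑ m, Pmat G ν l m = 1 := by
  have h : ∀ m, Pmat G ν l m = (if m = l then 1 - pconst G ν * denomP G ν l else 0) +
      pconst G ν * ((if l < m ∧ G.Adj l m then (1 : ℝ) else 0) +
        if m < l ∧ G.Adj l m then ν m / ν l else 0) := fun m => by
    rcases lt_trichotomy l m with hlm | rfl | hlm
    · rw [Pmat_apply_of_lt hlm]
      simp [hlm, hlm.ne', hlm.not_gt]
    · simp [Pmat_apply_self]
    · rw [Pmat_apply_of_gt hlm]
      simp [hlm, hlm.ne, hlm.not_gt, mul_comm]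
  simp_rw [h, Finset.sum_add_distrib, ← Finset.mul_sum, Finset.sum_add_distrib]
  simp [denomP]

lemma Pmat_detailed_balance (hν : ∀ l, 0 < ν l) (l m : V) :
    ν l * Pmat G ν l m = ν m * Pmat G ν m l := by
  have key : ∀ l m : V, l < m → ν l * Pmat G ν l m = ν m * Pmat G ν m l := fun l m h => by
    rw [Pmat_apply_of_lt h, Pmat_apply_of_gt h, G.adj_comm m l]
    have := (hν m).ne'
    split_ifs
    · field_simp
    · simp
  rcases lt_trichotomy l m with h | rfl | h
  · exact key l m h
  · rfl
  · exact (key m l h).symm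

lemma Pmat_invariant (hν : ∀ l, 0 < ν l) (m : V) : ∑ l, ν l * Pmat G ν l m = ν m := by
  simp_rw [Pmat_detailed_balance hν _ m, ← Finset.mul_sum, Pmat_row_sum, mul_one]

lemma adj_of_Pmat_ne_zero {l m : V} (h : Pmat G ν l m ≠ 0) : l = m ∨ G.Adj l m := by
  by_contra! hlm
  exact h (by simp [Pmat, hlm.1, hlm.2])

lemma denomP_pos (hν : ∀ l, 0 < ν l) {l m : V} (h : G.Adj l m) : 0 < denomP G ν l := by
  have h1 : ∀ m, 0 ≤ if l < m ∧ G.Adj l m then (1 : ℝ) else 0 := fun m => by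
    split_ifs <;> norm_num
  have h2 : ∀ m, 0 ≤ if m < l ∧ G.Adj l m then ν m / ν l else 0 := fun m => by
    split_ifs
    · exact (div_pos (hν m) (hν l)).le
    · exact le_rfl
  rcases lt_or_gt_of_ne h.ne with hlm | hlm
  · refine add_pos_of_pos_of_nonneg
      (Finset.sum_pos' (fun m _ => h1 m) ⟨m, mem_univ m, ?_⟩) (Finset.sum_nonneg fun m _ => h2 m)
    simp [hlm, h]
  · refine add_pos_of_nonneg_of_pos (Finset.sum_nonneg fun m _ => h1 m)
      (Finset.sum_pos' (fun m _ => h2 m) ⟨m, mem_univ m, ?_⟩)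
    rw [if_pos ⟨hlm, h⟩]
    exact div_pos (hν m) (hν l)

lemma pconst_pos (hν : ∀ l, 0 < ν l) (hG : G.Connected) {l m : V} (h : G.Adj l m) :
    0 < pconst G ν := by
  have : Nontrivial V := ⟨l, m, h.ne⟩
  obtain ⟨k, hk⟩ := exists_eq_ciInf_of_finite (f := fun l => 1 / (2 * denomP G ν l))
  obtain ⟨k', hk'⟩ := hG.preconnected.exists_adj_of_nontrivial k
  rw [pconst, ← hk]
  have := denomP_pos hν hk'
  positivity

lemma Pmat_pos_of_adj (hν : ∀ l, 0 < ν l) (hG : G.Connected) {l m : V} (h : G.Adj l m) :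
    0 < Pmat G ν l m := by
  have hp := pconst_pos hν hG h
  rcases lt_or_gt_of_ne h.ne with hlm | hlm
  · rwa [Pmat_apply_of_lt hlm, if_pos h]
  · rw [Pmat_apply_of_gt hlm, if_pos h]
    exact mul_pos (div_pos (hν m) (hν l)) hp

lemma Pmat_nonneg_of_ne (hν : ∀ l, 0 < ν l) (hG : G.Connected) {l m : V} (h : l ≠ m) :
    0 ≤ Pmat G ν l m := by
  by_cases hlm : G.Adj l m
  · exact (Pmat_pos_of_adj hν hG hlm).le
  · simp [Pmat, h, hlm]

lemma eq_of_Pmat_harmonic (hν : ∀ l, 0 < ν l) (hG : G.Connected) {h : V → ℝ}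
    (hh : ∀ l, ∑ m, Pmat G ν l m * h m = h l) (l m : V) : h l = h m := by
  obtain ⟨w⟩ := hG.preconnected l m
  induction w with
  | nil => rfl
  | cons hadj _ ih =>
    exact (eq_of_harmonic_of_invariant Pmat_row_sum (fun _ _ => Pmat_nonneg_of_ne hν hG) hν
      (Pmat_invariant hν) hh (Pmat_pos_of_adj hν hG hadj)).trans ih

end TransitionMatrix

theorem stmt_12 {N : ℕ} (G : SimpleGraph (Fin N))
    (μ : Fin N → ℝ) (hμ0 : ∀ s, 0 ≤ μ s) (hμ1 : ∑ s, μ s = 1)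
    (hconn : (G.induce {s : Fin N | 0 < μ s}).Connected)
    (hord : ∀ a b : {s : Fin N | 0 < μ s}, a ≤ b → μ b.1 ≤ μ a.1)
    {Ω : Type*} [MeasurableSpace Ω] (P : Measure Ω) [IsProbabilityMeasure P]
    (X : ℕ → Ω → {s : Fin N | 0 < μ s}) (hX : ∀ t, Measurable (X t))
    (hMarkov : IsMarkovOn P X fun _ =>
      Pmat (G.induce {s : Fin N | 0 < μ s}) (fun a => μ a.1)) :
    (∀ t : ℕ, P {ω | (X t ω : Fin N) = (X (t + 1) ω : Fin N)
        ∨ G.Adj (X t ω : Fin N) (X (t + 1) ω : Fin N)} = 1) ∧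
    ∀ s : Fin N, ∀ᵐ ω ∂P,
      Tendsto (fun t : ℕ =>
          (∑ m ∈ Finset.range t, if (X m ω : Fin N) = s then (1 : ℝ) else 0) / t)
        atTop (nhds (μ s)) := by
  have hν : ∀ a : {s : Fin N | 0 < μ s}, 0 < μ a.1 := fun a => a.2
  refine ⟨fun t => ?_, fun s => ?_⟩
  · refine (measure_congr (eventuallyEq_univ.2 ?_)).trans measure_univ
    filter_upwards [hMarkov.ae_transition_ne_zero t] with ω hω
    exact (adj_of_Pmat_ne_zero hω).imp (congrArg Subtype.val) id
  · have hsum : ∀ φ : Fin N → ℝ, ∑ a : {s : Fin N | 0 < μ s}, μ a.1 * φ a.1 =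
        ∑ a, μ a * φ a := fun φ => by
      rw [← Finset.sum_subtype (univ.filter fun a => 0 < μ a) (by simp) fun a => μ a * φ a]
      refine Finset.sum_subset (Finset.subset_univ _) fun a _ ha => ?_
      have : μ a = 0 := le_antisymm (by simpa using ha) (hμ0 a)
      rw [this, zero_mul]
    have h := hMarkov.ae_tendsto_average hX Pmat_row_sum
      (by simpa [hμ1] using hsum fun _ => 1) (Pmat_invariant hν)
      (fun _ => eq_of_Pmat_harmonic hν hconn) fun a => if a.1 = s then 1 else 0
    rw [hsum fun a => if a = s then 1 else 0] at h
    simpa using h
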